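/- Let K = B₂ⁿ / vol_n(B₂ⁿ)^{1/n}, L = (1/2) B_∞ⁿ, a = 1, b = 1/(e−1), and M_n = co[(K, −a), (L, b)] ⊆ ℝ^{n+1}. Let s₀ = −(√e − 1)/(√e + 1/(e−1)) and s₁ = (2 − √(eπ))/(√(eπ) + 2/(e−1)). Then for every ε > 0 there is n₀ such that for all n ≥ n₀ the (n+1)-st coordinate of the centroid of the polar body M_n^∘ satisfies s₀ − ε ≤ ⟨g(M_n^∘), e_{n+1}⟩ ≤ s₁ + ε. -/

import Mathlib

open MeasureTheory Filter
open scoped Pointwise RealInnerProductSpace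

/-- The centroid (center of gravity) of a set `K`: `(1/vol K) ∫_K x dx`. -/
noncomputable def centroid {E : Type*} [NormedAddCommGroup E] [NormedSpace ℝ E]
    [MeasureSpace E] (K : Set E) : E :=
  ((volume K).toReal)⁻¹ • ∫ x in K, x

/-- The polar body of a subset of `ℝⁿ × ℝ = ℝ^{n+1}` (with respect to `0`). -/
def polarProd {n : ℕ} (M : Set (EuclideanSpace ℝ (Fin n) × ℝ)) :
    Set (EuclideanSpace ℝ (Fin n) × ℝ) :=
  {y | ∀ z ∈ M, ⟪y.1, z.1⟫ + y.2 * z.2 ≤ 1}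

/-- `K = B₂ⁿ / vol_n(B₂ⁿ)^{1/n}`, the Euclidean ball normalized to volume `1`. -/
noncomputable def normBall (n : ℕ) : Set (EuclideanSpace ℝ (Fin n)) :=
  ((volume (Metric.closedBall (0 : EuclideanSpace ℝ (Fin n)) 1)).toReal ^ (1 / (n : ℝ)))⁻¹ •
    Metric.closedBall (0 : EuclideanSpace ℝ (Fin n)) 1

/-- `L = (1/2) B_∞ⁿ`, the cube of volume `1`. -/
noncomputable def normCube (n : ℕ) : Set (EuclideanSpace ℝ (Fin n)) :=
  (1 / 2 : ℝ) • {x : EuclideanSpace ℝ (Fin n) | ∀ i, |x i| ≤ 1}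

/-- `M_n = co[(K, -a), (L, b)] ⊆ ℝ^{n+1}`. -/
noncomputable def Mbody (a b : ℝ) (n : ℕ) : Set (EuclideanSpace ℝ (Fin n) × ℝ) :=
  convexHull ℝ ((normBall n ×ˢ ({-a} : Set ℝ)) ∪ (normCube n ×ˢ ({b} : Set ℝ)))

lemma aux_exp_tail (u : ℝ) :
    ∫⁻ t in Set.Ici u, ENNReal.ofReal (Real.exp (-t)) = ENNReal.ofReal (Real.exp (-u)) := by
  rw [setLIntegral_congr (Ioi_ae_eq_Ici (a := u)).symm, ← integral_exp_neg_Ioi u,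
    ofReal_integral_eq_lintegral_ofReal]
  · exact integrableOn_exp_neg_Ioi u
  · exact Eventually.of_forall fun t => (Real.exp_pos _).le

lemma aux_scale {n : ℕ} {p q : ℝ} (hp : 0 < p) (Q : (Fin n → ℝ) → ℝ) (g : (Fin n → ℝ) → ENNReal)
    (hQm : Measurable Q) (hgm : Measurable g)
    (hQ : ∀ r : ℝ, 0 < r → ∀ x, Q (r • x) = r ^ p * Q x)
    (hg : ∀ r : ℝ, 0 < r → ∀ x, g (r • x) = ENNReal.ofReal (r ^ q) * g x) (u : ℝ) (hu : 0 < u) :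
    ∫⁻ x in {x | Q x ≤ u}, g x
      = ENNReal.ofReal (u ^ ((n + q) / p)) * ∫⁻ x in {x | Q x ≤ 1}, g x := by
  set r : ℝ := u ^ (1 / p) with hr
  have hr0 : 0 < r := Real.rpow_pos_of_pos hu _
  have hrp : r ^ p = u := by
    rw [hr, ← Real.rpow_mul hu.le]; field_simp; simp
  have hmeas : ∀ v : ℝ, MeasurableSet {x | Q x ≤ v} := fun v => measurableSet_le hQm measurable_const
  set h : (Fin n → ℝ) → ENNReal := Set.indicator {x | Q x ≤ 1} g with hh
  have hhm : Measurable h := hgm.indicator (hmeas 1)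
  have key : ∀ x, Set.indicator {x | Q x ≤ u} g x = ENNReal.ofReal (r ^ q) * h (r⁻¹ • x) := by
    intro x
    have hx : x = r • (r⁻¹ • x) := by rw [smul_smul, mul_inv_cancel₀ hr0.ne', one_smul]
    have h1 : Q x = u * Q (r⁻¹ • x) := by
      conv_lhs => rw [hx, hQ r hr0, hrp]
    have h2 : g x = ENNReal.ofReal (r ^ q) * g (r⁻¹ • x) := by
      conv_lhs => rw [hx, hg r hr0]
    have h3 : Q x ≤ u ↔ Q (r⁻¹ • x) ≤ 1 := by
      rw [h1]; constructor
      · intro h; nlinarith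
      · intro h; nlinarith
    by_cases hc : Q x ≤ u
    · rw [Set.indicator_of_mem (by exact hc), hh, Set.indicator_of_mem (by exact h3.1 hc), h2]
    · rw [Set.indicator_of_notMem (by exact hc), hh,
        Set.indicator_of_notMem (by exact fun h => hc (h3.2 h)), mul_zero]
  rw [← lintegral_indicator (hmeas u), ← lintegral_indicator (hmeas 1), ← hh]
  simp_rw [key]
  rw [lintegral_const_mul _ (show Measurable fun x => h (r⁻¹ • x) from hhm.comp (measurable_const_smul _))]
  have hmap := Measure.map_addHaar_smul (volume : Measure (Fin n → ℝ)) (inv_ne_zero hr0.ne')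
  have : ∫⁻ x, h (r⁻¹ • x) = ENNReal.ofReal (r ^ (n:ℝ)) * ∫⁻ x, h x := by
    rw [← lintegral_map (f := h) hhm (measurable_const_smul r⁻¹), hmap, lintegral_smul_measure]
    simp [abs_of_pos hr0]
  rw [this, ← mul_assoc, ← ENNReal.ofReal_mul (by positivity)]
  congr 2
  rw [← Real.rpow_add hr0, hr, ← Real.rpow_mul hu.le]
  congr 1; field_simp; ring

lemma aux_layer {n : ℕ} {p q : ℝ} (hp : 0 < p) (hq : 0 ≤ q)
    (Q : (Fin n → ℝ) → ℝ) (g : (Fin n → ℝ) → ENNReal)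
    (hQm : Measurable Q) (hgm : Measurable g) (hQ0 : ∀ x, 0 ≤ Q x)
    (hQ : ∀ r : ℝ, 0 < r → ∀ x, Q (r • x) = r ^ p * Q x)
    (hg : ∀ r : ℝ, 0 < r → ∀ x, g (r • x) = ENNReal.ofReal (r ^ q) * g x) :
    ∫⁻ x, g x * ENNReal.ofReal (Real.exp (-Q x))
      = ENNReal.ofReal (Real.Gamma ((n + q) / p + 1)) * ∫⁻ x in {x | Q x ≤ 1}, g x := by
  have e1 : ∀ x, g x * ENNReal.ofReal (Real.exp (-Q x)) =
      ∫⁻ t in Set.Ioi (0:ℝ), ({z : (Fin n → ℝ) × ℝ | Q z.1 ≤ z.2}).indicator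
        (fun z => g z.1 * ENNReal.ofReal (Real.exp (-z.2))) (x, t) := by
    intro x
    have : ∀ t, ({z : (Fin n → ℝ) × ℝ | Q z.1 ≤ z.2}).indicator
        (fun z => g z.1 * ENNReal.ofReal (Real.exp (-z.2))) (x, t) =
        (Set.Ici (Q x)).indicator (fun t => g x * ENNReal.ofReal (Real.exp (-t))) t := by
      intro t; rfl
    simp_rw [this]
    rw [lintegral_indicator measurableSet_Ici, Measure.restrict_restrict measurableSet_Ici]
    rw [lintegral_const_mul _ (by fun_prop), ← aux_exp_tail (Q x)]
    congr 1
    refine (setLIntegral_congr ?_).symm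
    have : Set.Ici (Q x) =ᵐ[volume] (Set.Ici (Q x) ∩ Set.Ici 0 : Set ℝ) := by
      have : Set.Ici (Q x) ∩ Set.Ici 0 = Set.Ici (Q x) :=
        Set.inter_eq_left.2 (Set.Ici_subset_Ici.2 (hQ0 x))
      rw [this]
      exact ae_eq_refl _
    refine ((ae_eq_refl _).inter (Ioi_ae_eq_Ici (a := (0:ℝ)))).trans this.symm
  have hS : MeasurableSet {z : (Fin n → ℝ) × ℝ | Q z.1 ≤ z.2} :=
    measurableSet_le (hQm.comp measurable_fst) measurable_snd
  simp_rw [e1]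
  rw [lintegral_lintegral_swap]
  swap
  · apply Measurable.aemeasurable
    apply Measurable.indicator _ hS
    exact (hgm.comp measurable_fst).mul (by fun_prop)
  have e2 : ∀ t ∈ Set.Ioi (0:ℝ), ∫⁻ x, ({z : (Fin n → ℝ) × ℝ | Q z.1 ≤ z.2}).indicator
        (fun z => g z.1 * ENNReal.ofReal (Real.exp (-z.2))) (x, t) =
        ENNReal.ofReal (Real.exp (-t) * t ^ ((n + q) / p + 1 - 1)) * ∫⁻ x in {x | Q x ≤ 1}, g x := by
    intro t ht
    have : ∀ x, ({z : (Fin n → ℝ) × ℝ | Q z.1 ≤ z.2}).indicator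
        (fun z => g z.1 * ENNReal.ofReal (Real.exp (-z.2))) (x, t) =
        ({x | Q x ≤ t}).indicator (fun x => g x * ENNReal.ofReal (Real.exp (-t))) x := by
      intro x; rfl
    simp_rw [this]
    rw [lintegral_indicator (measurableSet_le hQm measurable_const), lintegral_mul_const _ hgm,
      aux_scale hp Q g hQm hgm hQ hg t ht, ENNReal.ofReal_mul (Real.exp_pos _).le]
    simp only [add_sub_cancel_right]
    ring
  have hs : 0 < (n + q) / p + 1 := by positivity
  rw [setLIntegral_congr_fun measurableSet_Ioi e2, lintegral_mul_const _ (by fun_prop),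
    Real.Gamma_eq_integral hs, ofReal_integral_eq_lintegral_ofReal (Real.GammaIntegral_convergent hs)]
  filter_upwards [ae_restrict_mem measurableSet_Ioi] with t ht
  have : (0:ℝ) < t := ht
  positivity

lemma aux_one_dim {p q : ℝ} (hp : 0 < p) (hq : 0 ≤ q) :
    ∫ x : ℝ, |x| ^ q * Real.exp (-|x| ^ p) = 2 / p * Real.Gamma ((q + 1) / p) := by
  rw [integral_comp_abs (f := fun x => x ^ q * Real.exp (-x ^ p)),
    integral_rpow_mul_exp_neg_rpow hp (by linarith)]
  ring

lemma aux_one_dim_int {p q : ℝ} (hp : 0 < p) (hq : 0 ≤ q) :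
    Integrable (fun x : ℝ => |x| ^ q * Real.exp (-|x| ^ p)) := by
  apply Integrable.of_integral_ne_zero
  rw [aux_one_dim hp hq]
  have : 0 < Real.Gamma ((q + 1) / p) := Real.Gamma_pos_of_pos (by positivity)
  positivity

/-- product integrals with different powers per coordinate -/
lemma aux_prod {n : ℕ} {p : ℝ} (hp : 0 < p) (q : Fin n → ℝ) (hq : ∀ i, 0 ≤ q i) :
    ∫⁻ x : Fin n → ℝ, ENNReal.ofReal (∏ i, |x i| ^ q i) *
        ENNReal.ofReal (Real.exp (-∑ i, |x i| ^ p))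
      = ENNReal.ofReal (∏ i, (2 / p * Real.Gamma ((q i + 1) / p))) := by
  have e : ∀ x : Fin n → ℝ, ENNReal.ofReal (∏ i, |x i| ^ q i) *
        ENNReal.ofReal (Real.exp (-∑ i, |x i| ^ p)) =
        ENNReal.ofReal (∏ i, (|x i| ^ q i * Real.exp (-|x i| ^ p))) := by
    intro x
    rw [← ENNReal.ofReal_mul (Finset.prod_nonneg fun i _ => by positivity),
      ← Finset.sum_neg_distrib, Real.exp_sum, Finset.prod_mul_distrib]
  simp_rw [e]
  rw [← ofReal_integral_eq_lintegral_ofReal]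
  · rw [integral_fintype_prod_volume_eq_prod
      (fun i (y : ℝ) => |y| ^ q i * Real.exp (-|y| ^ p))]
    congr 1
    exact Finset.prod_congr rfl fun i _ => aux_one_dim hp (hq i)
  · exact Integrable.fintype_prod (f := fun i (y : ℝ) => |y| ^ q i * Real.exp (-|y| ^ p))
      (fun i => aux_one_dim_int hp (hq i))
  · exact Eventually.of_forall fun x => Finset.prod_nonneg fun i _ => by positivity

lemma aux_hom {n : ℕ} (p : ℝ) (r : ℝ) (hr : 0 < r) (x : Fin n → ℝ) :
    ∑ i, |(r • x) i| ^ p = r ^ p * ∑ i, |x i| ^ p := by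
  rw [Finset.mul_sum]
  refine Finset.sum_congr rfl fun i _ => ?_
  rw [Pi.smul_apply, smul_eq_mul, abs_mul, abs_of_pos hr, Real.mul_rpow hr.le (abs_nonneg _)]

lemma aux_meas {n : ℕ} (p : ℝ) : Measurable (fun x : Fin n → ℝ => ∑ i, |x i| ^ p) := by
  fun_prop

/-- volume of `{∑ |x_i|^p ≤ 1}` -/
lemma aux_vol {n : ℕ} {p : ℝ} (hp : 0 < p) :
    ENNReal.ofReal (Real.Gamma (n / p + 1)) * volume {x : Fin n → ℝ | ∑ i, |x i| ^ p ≤ 1}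
      = ENNReal.ofReal ((2 / p * Real.Gamma (1 / p)) ^ n) := by
  have h1 := aux_layer (n := n) hp le_rfl (fun x => ∑ i, |x i| ^ p) (fun _ => 1) (aux_meas p)
    measurable_const (fun x => Finset.sum_nonneg fun i _ => by positivity) (aux_hom p)
    (by intro r hr x; simp)
  have h2 := aux_prod (n := n) hp (fun _ => 0) (fun _ => le_rfl)
  simp only [Real.rpow_zero, Finset.prod_const_one, ENNReal.ofReal_one] at h2
  rw [h2] at h1
  simpa using h1.symm

lemma aux_moment {n : ℕ} {p q : ℝ} (hp : 0 < p) (hq : 0 ≤ q) :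
    ENNReal.ofReal (Real.Gamma ((n + q) / p + 1)) *
      ∫⁻ x in {x : Fin n → ℝ | ∑ i, |x i| ^ p ≤ 1}, ENNReal.ofReal (∑ i, |x i| ^ q)
      = ENNReal.ofReal (n * ((2 / p * Real.Gamma ((q + 1) / p)) *
          (2 / p * Real.Gamma (1 / p)) ^ (n - 1))) := by
  rw [← aux_layer (n := n) hp hq (fun x => ∑ i, |x i| ^ p) (fun x => ENNReal.ofReal (∑ i, |x i| ^ q))
    (aux_meas p) (aux_meas q).ennreal_ofReal
    (fun x => Finset.sum_nonneg fun i _ => by positivity) (aux_hom p)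
    (by intro r hr x; rw [aux_hom q r hr, ENNReal.ofReal_mul (by positivity)])]
  have e : ∀ x : Fin n → ℝ, ENNReal.ofReal (∑ i, |x i| ^ q) *
      ENNReal.ofReal (Real.exp (-∑ i, |x i| ^ p)) =
      ∑ k, ENNReal.ofReal (∏ i, |x i| ^ (if i = k then q else 0)) *
        ENNReal.ofReal (Real.exp (-∑ i, |x i| ^ p)) := by
    intro x
    rw [← Finset.sum_mul, ← ENNReal.ofReal_sum_of_nonneg]
    · congr 2
      refine Finset.sum_congr rfl fun k _ => ?_
      rw [Finset.prod_eq_single k]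
      · simp
      · intro b _ hb; simp [hb]
      · simp
    · intro k _; exact Finset.prod_nonneg fun i _ => by positivity
  simp_rw [e]
  rw [lintegral_finsetSum]
  · have hk : ∀ k : Fin n, ∫⁻ x : Fin n → ℝ, ENNReal.ofReal (∏ i, |x i| ^ (if i = k then q else 0)) *
        ENNReal.ofReal (Real.exp (-∑ i, |x i| ^ p)) = ENNReal.ofReal ((2 / p * Real.Gamma ((q + 1) / p)) *
          (2 / p * Real.Gamma (1 / p)) ^ (n - 1)) := by
      intro k
      rw [aux_prod hp (fun i => if i = k then q else 0) (by intro i; split_ifs <;> simp [hq])]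
      congr 1
      rw [← Finset.mul_prod_erase Finset.univ _ (Finset.mem_univ k)]
      congr 1
      · simp
      · rw [Finset.prod_congr rfl (g := fun _ => 2 / p * Real.Gamma (1 / p))]
        · simp
        · intro i hi; simp [Finset.ne_of_mem_erase hi]
    simp_rw [hk]
    rw [Finset.sum_const, Finset.card_univ, Fintype.card_fin, nsmul_eq_mul,
      ENNReal.ofReal_mul (p := (n:ℝ)) (by positivity), ENNReal.ofReal_natCast]
  · intro k _
    fun_prop

lemma aux_C_pos {p q : ℝ} (hp : 0 < p) (hq : 0 ≤ q) : 0 < 2 / p * Real.Gamma ((q + 1) / p) := by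
  have : 0 < Real.Gamma ((q + 1) / p) := Real.Gamma_pos_of_pos (by positivity)
  positivity

lemma aux_vol' {n : ℕ} {p : ℝ} (hp : 0 < p) :
    volume {x : Fin n → ℝ | ∑ i, |x i| ^ p ≤ 1}
      = ENNReal.ofReal ((2 / p * Real.Gamma (1 / p)) ^ n / Real.Gamma (n / p + 1)) := by
  have hG : 0 < Real.Gamma (n / p + 1) := Real.Gamma_pos_of_pos (by positivity)
  rw [ENNReal.ofReal_div_of_pos hG, ← aux_vol hp, mul_comm, ENNReal.mul_div_cancel_right]
  · simpa using hG
  · exact ENNReal.ofReal_ne_top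

lemma aux_vol_scale {n : ℕ} {p : ℝ} (hp : 0 < p) (u : ℝ) (hu : 0 < u) :
    volume {x : Fin n → ℝ | ∑ i, |x i| ^ p ≤ u}
      = ENNReal.ofReal (u ^ (n / p)) * volume {x : Fin n → ℝ | ∑ i, |x i| ^ p ≤ 1} := by
  have := aux_scale (n := n) (q := 0) hp (fun x => ∑ i, |x i| ^ p) (fun _ => 1) (aux_meas p)
    measurable_const (aux_hom p) (by intro r hr x; simp) u hu
  simpa using this

lemma aux_moment' {n : ℕ} (hn : 1 ≤ n) {p q c : ℝ} (hp : 0 < p) (hq : 0 ≤ q) (hc0 : 0 ≤ c)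
    (hc : n * (2 / p * Real.Gamma ((q + 1) / p)) * Real.Gamma (n / p + 1) ≤
      c * (2 / p * Real.Gamma (1 / p)) * Real.Gamma ((n + q) / p + 1)) :
    ∫⁻ x in {x : Fin n → ℝ | ∑ i, |x i| ^ p ≤ 1}, ENNReal.ofReal (∑ i, |x i| ^ q) ≤
      ENNReal.ofReal c * volume {x : Fin n → ℝ | ∑ i, |x i| ^ p ≤ 1} := by
  have hG : 0 < Real.Gamma (n / p + 1) := Real.Gamma_pos_of_pos (by positivity)
  have hG' : 0 < Real.Gamma ((n + q) / p + 1) := Real.Gamma_pos_of_pos (by positivity)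
  have hC : 0 < 2 / p * Real.Gamma (1 / p) := by simpa using aux_C_pos (q := 0) hp le_rfl
  have h := aux_moment (n := n) hp hq
  rw [aux_vol' hp, ← ENNReal.ofReal_mul hc0,
    ← ENNReal.mul_le_mul_iff_right (a := ENNReal.ofReal (Real.Gamma ((n + q) / p + 1)))
      (by simpa using hG') ENNReal.ofReal_ne_top, h, ← ENNReal.ofReal_mul hG'.le]
  apply ENNReal.ofReal_le_ofReal
  obtain ⟨m, rfl⟩ : ∃ m, n = m + 1 := ⟨n - 1, by omega⟩
  set A := 2 / p * Real.Gamma ((q + 1) / p)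
  set C := 2 / p * Real.Gamma (1 / p)
  set N := ((m + 1 : ℕ) : ℝ)
  rw [show m + 1 - 1 = m by omega, show Real.Gamma ((N + q) / p + 1) * (c * (C ^ (m + 1) / Real.Gamma (N / p + 1))) = (c * C * Real.Gamma ((N + q) / p + 1)) * C ^ m / Real.Gamma (N / p + 1) by
    rw [pow_succ]; ring, le_div_iff₀ hG]
  calc N * (A * C ^ m) * Real.Gamma (N / p + 1) = (N * A * Real.Gamma (N / p + 1)) * C ^ m := by ring
    _ ≤ _ := by gcongr

lemma aux_markov {n : ℕ} (hn : 1 ≤ n) {p q c : ℝ} (hp : 0 < p) (hq : 0 ≤ q) (hc0 : 0 ≤ c)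
    (hc : n * (2 / p * Real.Gamma ((q + 1) / p)) * Real.Gamma (n / p + 1) ≤
      c * (2 / p * Real.Gamma (1 / p)) * Real.Gamma ((n + q) / p + 1))
    {u T κ : ℝ} (hu : 0 < u) (hT : 0 < T) (hκ0 : 0 ≤ κ) (hκ1 : κ ≤ 1)
    (h : c * u ^ (q / p) ≤ (1 - κ) * T) :
    ENNReal.ofReal κ * volume {x : Fin n → ℝ | ∑ i, |x i| ^ p ≤ u} ≤
      volume {x : Fin n → ℝ | ∑ i, |x i| ^ p ≤ u ∧ ∑ i, |x i| ^ q ≤ T} := by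
  set S := {x : Fin n → ℝ | ∑ i, |x i| ^ p ≤ u} with hS
  have hSm : MeasurableSet S := measurableSet_le (aux_meas p) measurable_const
  set B := {x : Fin n → ℝ | ENNReal.ofReal T ≤ ENNReal.ofReal (∑ i, |x i| ^ q)}
  have hBm : MeasurableSet B := measurableSet_le measurable_const (aux_meas q).ennreal_ofReal
  have hfin : volume S ≠ ⊤ := by
    rw [hS, aux_vol_scale hp u hu, aux_vol' hp]
    exact ENNReal.mul_ne_top ENNReal.ofReal_ne_top ENNReal.ofReal_ne_top
  have hF : ∫⁻ x in S, ENNReal.ofReal (∑ i, |x i| ^ q) ≤ ENNReal.ofReal T * (ENNReal.ofReal (1 - κ) * volume S) := by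
    rw [hS, aux_scale (n := n) (q := q) hp (fun x => ∑ i, |x i| ^ p)
      (fun x => ENNReal.ofReal (∑ i, |x i| ^ q)) (aux_meas p)
      (aux_meas q).ennreal_ofReal (aux_hom p)
      (by intro r hr x; rw [aux_hom q r hr, ENNReal.ofReal_mul (by positivity)]) u hu,
      aux_vol_scale hp u hu]
    calc _ ≤ ENNReal.ofReal (u ^ ((n + q) / p)) * (ENNReal.ofReal c * volume {x : Fin n → ℝ | ∑ i, |x i| ^ p ≤ 1}) := by
          gcongr; exact aux_moment' hn hp hq hc0 hc
      _ = ENNReal.ofReal (u ^ (n / p)) * ENNReal.ofReal (c * u ^ (q / p)) * volume {x : Fin n → ℝ | ∑ i, |x i| ^ p ≤ 1} := by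
          rw [← mul_assoc, ← ENNReal.ofReal_mul (by positivity), ← ENNReal.ofReal_mul (by positivity),
            add_div, Real.rpow_add hu]
          congr 2; ring
      _ ≤ ENNReal.ofReal (u ^ (n / p)) * ENNReal.ofReal ((1 - κ) * T) * volume {x : Fin n → ℝ | ∑ i, |x i| ^ p ≤ 1} := by
          gcongr
      _ = _ := by
          rw [ENNReal.ofReal_mul (by linarith)]; ring
  have hB : volume (B ∩ S) ≤ ENNReal.ofReal (1 - κ) * volume S := by
    have h1 := mul_meas_ge_le_lintegral (μ := volume.restrict S) (aux_meas q).ennreal_ofReal (ENNReal.ofReal T)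
    rw [Measure.restrict_apply hBm] at h1
    exact (ENNReal.mul_le_mul_iff_right (by simpa using hT) ENNReal.ofReal_ne_top).1 (h1.trans hF)
  have hsub : S ⊆ {x : Fin n → ℝ | ∑ i, |x i| ^ p ≤ u ∧ ∑ i, |x i| ^ q ≤ T} ∪ (B ∩ S) := by
    intro x hx
    by_cases hxT : ∑ i, |x i| ^ q ≤ T
    · exact Or.inl ⟨hx, hxT⟩
    · exact Or.inr ⟨ENNReal.ofReal_le_ofReal (not_le.1 hxT).le, hx⟩
  have h2 : volume S ≤ volume {x : Fin n → ℝ | ∑ i, |x i| ^ p ≤ u ∧ ∑ i, |x i| ^ q ≤ T} +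
      ENNReal.ofReal (1 - κ) * volume S :=
    (measure_mono hsub).trans ((measure_union_le _ _).trans (by gcongr))
  have h3 : volume S = ENNReal.ofReal κ * volume S + ENNReal.ofReal (1 - κ) * volume S := by
    rw [← add_mul, ← ENNReal.ofReal_add hκ0 (by linarith)]; simp
  rw [h3] at h2
  have hf2 : ENNReal.ofReal (1 - κ) * volume S ≠ ⊤ := ENNReal.mul_ne_top ENNReal.ofReal_ne_top hfin
  have h4 := (ENNReal.add_le_add_iff_right hf2).1 (by
    calc ENNReal.ofReal κ * volume S + ENNReal.ofReal (1 - κ) * volume S = volume S := h3.symm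
      _ ≤ _ := (measure_mono hsub).trans ((measure_union_le _ _).trans (add_le_add le_rfl hB)))
  exact h4

/-- ball: `ℓ1` norm -/
lemma aux_markov_ball {n : ℕ} (hn : 1 ≤ n) {R T κ : ℝ} (hR : 0 < R) (hT : 0 < T) (hκ0 : 0 ≤ κ)
    (hκ1 : κ ≤ 1) (h : √(2 * n / Real.pi) * R ≤ (1 - κ) * T) :
    ENNReal.ofReal κ * volume {x : Fin n → ℝ | ∑ i, |x i| ^ (2:ℝ) ≤ R ^ 2} ≤
      volume {x : Fin n → ℝ | ∑ i, |x i| ^ (2:ℝ) ≤ R ^ 2 ∧ ∑ i, |x i| ^ (1:ℝ) ≤ T} := by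
  refine aux_markov hn (c := √(2 * n / Real.pi)) (by norm_num) (by norm_num) (by positivity) ?_
    (by positivity) hT hκ0 hκ1 ?_
  · have hn' : (1:ℝ) ≤ n := by exact_mod_cast hn
    norm_num [Real.Gamma_one_half_eq]
    have hs : 0 < ((n:ℝ) + 1) / 2 := by positivity
    set x : ℝ := ((n:ℝ) + 1) / 2 with hx
    have hx2 : (n:ℝ) / 2 + 1 = x + 1 / 2 := by rw [hx]; ring
    rw [hx2]
    have hlog := Real.Gamma_mul_add_mul_le_rpow_Gamma_mul_rpow_Gamma (s := x) (t := x + 1)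
      (a := 1 / 2) (b := 1 / 2) hs (by positivity) (by norm_num) (by norm_num) (by norm_num)
    rw [show (1 / 2 : ℝ) * x + 1 / 2 * (x + 1) = x + 1 / 2 by ring, ← Real.sqrt_eq_rpow,
      ← Real.sqrt_eq_rpow, Real.Gamma_add_one hs.ne'] at hlog
    have hG : 0 < Real.Gamma x := Real.Gamma_pos_of_pos hs
    have e1 : √(Real.Gamma x) * √(x * Real.Gamma x) = √x * Real.Gamma x := by
      rw [Real.sqrt_mul hs.le, mul_comm (√x), ← mul_assoc, Real.mul_self_sqrt hG.le]; ring
    rw [e1] at hlog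
    rw [Real.Gamma_add_one hs.ne']
    have e2 : √(2 * (n:ℝ)) / √Real.pi * √Real.pi = √(2 * n) := by
      field_simp
    have e3 : (n:ℝ) ≤ √(2 * n) * √x := by
      rw [← Real.sqrt_mul (by positivity)]
      apply Real.le_sqrt_of_sq_le
      rw [hx]; nlinarith
    have e4 : √(2 * (n:ℝ) / Real.pi) * √Real.pi = √(2 * n) := by
      rw [← Real.sqrt_mul (by positivity)]; congr 1; field_simp
    have : n * Real.Gamma (x + 1 / 2) ≤ √(2 * n) * (x * Real.Gamma x) := by
      calc n * Real.Gamma (x + 1 / 2) ≤ (√(2 * n) * √x) * (√x * Real.Gamma x) := by gcongr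
        _ = √(2 * n) * ((√x * √x) * Real.Gamma x) := by ring
        _ = _ := by rw [Real.mul_self_sqrt hs.le]
    simp at e2 e4 this ⊢
    rw [e2]
    exact this
  · rw [← Real.rpow_natCast R 2, ← Real.rpow_mul hR.le]
    simpa using h

lemma aux_markov_cross {n : ℕ} (hn : 1 ≤ n) {R T κ : ℝ} (hR : 0 < R) (hT : 0 < T) (hκ0 : 0 ≤ κ)
    (hκ1 : κ ≤ 1) (h : 2 / n * R ^ 2 ≤ (1 - κ) * T) :
    ENNReal.ofReal κ * volume {x : Fin n → ℝ | ∑ i, |x i| ^ (1:ℝ) ≤ R} ≤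
      volume {x : Fin n → ℝ | ∑ i, |x i| ^ (1:ℝ) ≤ R ∧ ∑ i, |x i| ^ (2:ℝ) ≤ T} := by
  have hn' : (1:ℝ) ≤ n := by exact_mod_cast hn
  refine aux_markov hn (c := 2 / n) (by norm_num) (by norm_num) (by positivity) ?_
    hR hT hκ0 hκ1 ?_
  · have hG : 0 < Real.Gamma (n + 1) := Real.Gamma_pos_of_pos (by positivity)
    have h3 : Real.Gamma 3 = 2 := by
      rw [show (3:ℝ) = (2:ℕ) + 1 by norm_num, Real.Gamma_nat_eq_factorial]; simp
    have hG2 : Real.Gamma (((n:ℝ) + 2) / 1 + 1) = (n + 1 + 1) * ((n + 1) * Real.Gamma (n + 1)) := by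
      rw [show ((n:ℝ) + 2) / 1 + 1 = (n + 1 + 1) + 1 by ring, Real.Gamma_add_one (by positivity),
        Real.Gamma_add_one (by positivity)]
    rw [hG2, div_one (n:ℝ), show ((2:ℝ) + 1) / 1 = 3 by norm_num, h3, div_one (1:ℝ), Real.Gamma_one]
    set G := Real.Gamma ((n:ℝ) + 1)
    have e1 : (n:ℝ) * n ≤ (n + 1 + 1) * (n + 1) := by nlinarith
    have e2 : 2 / (n:ℝ) * (2 / 1 * 1) * ((n + 1 + 1) * ((n + 1) * G)) =
        4 * (((n + 1 + 1) * (n + 1)) * G) / n := by ring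
    rw [e2, le_div_iff₀ (by positivity)]
    nlinarith [mul_le_mul_of_nonneg_right e1 hG.le]
  · simpa using h

lemma aux_gamma_lower {x : ℝ} (hx : 0 < x) : (x / Real.exp 1) ^ x ≤ Real.Gamma (x + 1) := by
  have hint : IntegrableOn (fun t : ℝ => Real.exp (-t) * t ^ (x + 1 - 1)) (Set.Ioi 0) :=
    Real.GammaIntegral_convergent (by linarith)
  rw [Real.Gamma_eq_integral (by linarith)]
  calc (x / Real.exp 1) ^ x = ∫ t in Set.Ioi x, Real.exp (-t) * x ^ x := by
        rw [integral_mul_const, integral_exp_neg_Ioi, Real.div_rpow hx.le (Real.exp_pos 1).le,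
          ← Real.exp_mul, one_mul, Real.exp_neg]
        field_simp
    _ ≤ ∫ t in Set.Ioi x, Real.exp (-t) * t ^ (x + 1 - 1) := by
        apply setIntegral_mono_on
        · exact (integrableOn_exp_neg_Ioi x).mul_const _
        · exact hint.mono_set (Set.Ioi_subset_Ioi hx.le)
        · exact measurableSet_Ioi
        · intro t ht
          have ht' : x < t := ht
          rw [add_sub_cancel_right]
          gcongr
    _ ≤ _ := by
        apply setIntegral_mono_set hint
        · filter_upwards [ae_restrict_mem measurableSet_Ioi] with t ht
          have : (0:ℝ) < t := ht
          simp only [Pi.zero_apply]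
          positivity
        · exact (Set.Ioi_subset_Ioi hx.le).eventuallyLE

lemma aux_gamma_upper {x l : ℝ} (hx : 0 < x) (hl0 : 0 < l) (hl1 : l < 1) :
    Real.Gamma (x + 1) ≤ (x / (l * Real.exp 1)) ^ x / (1 - l) := by
  have hint : IntegrableOn (fun t : ℝ => Real.exp (-t) * t ^ (x + 1 - 1)) (Set.Ioi 0) :=
    Real.GammaIntegral_convergent (by linarith)
  have h1 : 0 < 1 - l := by linarith
  have hI : IntegrableOn (fun t : ℝ => Real.exp ((-(1 - l)) * t)) (Set.Ioi 0) :=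
    integrableOn_exp_mul_Ioi (by linarith) 0
  rw [Real.Gamma_eq_integral (by linarith)]
  calc _ ≤ ∫ t in Set.Ioi (0:ℝ), Real.exp ((-(1 - l)) * t) * (x / (l * Real.exp 1)) ^ x := by
        apply setIntegral_mono_on hint (hI.mul_const _) measurableSet_Ioi
        intro t ht
        have ht' : (0:ℝ) < t := ht
        rw [add_sub_cancel_right]
        have hb : t ≤ (x / (l * Real.exp 1)) * Real.exp (l * t / x) := by
          have := Real.add_one_le_exp (l * t / x - 1)
          rw [Real.exp_sub] at this
          have h2 : l * t / x ≤ Real.exp (l * t / x) / Real.exp 1 := by linarith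
          calc t = (x / l) * (l * t / x) := by field_simp
            _ ≤ (x / l) * (Real.exp (l * t / x) / Real.exp 1) := by gcongr
            _ = _ := by field_simp
        have hb2 : t ^ x ≤ (x / (l * Real.exp 1)) ^ x * Real.exp (l * t) := by
          calc t ^ x ≤ ((x / (l * Real.exp 1)) * Real.exp (l * t / x)) ^ x := by gcongr
            _ = _ := by
              rw [Real.mul_rpow (by positivity) (by positivity), ← Real.exp_mul]
              congr 2; field_simp
        calc Real.exp (-t) * t ^ x ≤ Real.exp (-t) * ((x / (l * Real.exp 1)) ^ x * Real.exp (l * t)) := by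
              gcongr
          _ = (Real.exp (-t) * Real.exp (l * t)) * (x / (l * Real.exp 1)) ^ x := by ring
          _ = _ := by rw [← Real.exp_add]; congr 2; ring
    _ = _ := by
        rw [integral_mul_const, integral_exp_mul_Ioi (by linarith)]
        simp only [mul_zero, Real.exp_zero, neg_div_neg_eq]
        ring

/-- normalising radius -/
noncomputable def vrad (n : ℕ) : ℝ :=
  (volume (Metric.closedBall (0 : EuclideanSpace ℝ (Fin n)) 1)).toReal ^ (1 / (n : ℝ))

lemma aux_ball_iff {n : ℕ} (y : EuclideanSpace ℝ (Fin n)) {R : ℝ} (hR : 0 ≤ R) :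
    ‖y‖ ≤ R ↔ ∑ i, |y i| ^ (2:ℝ) ≤ R ^ 2 := by
  rw [EuclideanSpace.norm_eq, Real.sqrt_le_left hR]
  simp

lemma aux_closedBall_vol (n : ℕ) :
    volume (Metric.closedBall (0 : EuclideanSpace ℝ (Fin n)) 1) =
      ENNReal.ofReal ((√Real.pi) ^ n / Real.Gamma (n / 2 + 1)) := by
  have h := aux_vol' (n := n) (p := 2) (by norm_num)
  rw [div_self (by norm_num), one_mul, Real.Gamma_one_half_eq] at h
  rw [← h, ← (PiLp.volume_preserving_ofLp (Fin n)).measure_preimage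
    (measurableSet_le (aux_meas 2) measurable_const).nullMeasurableSet]
  congr 1
  ext y
  rw [mem_closedBall_zero_iff, aux_ball_iff y zero_le_one]
  simp

lemma aux_vball (n : ℕ) :
    (volume (Metric.closedBall (0 : EuclideanSpace ℝ (Fin n)) 1)).toReal =
      (√Real.pi) ^ n / Real.Gamma (n / 2 + 1) := by
  have hG : 0 < Real.Gamma ((n:ℝ) / 2 + 1) := Real.Gamma_pos_of_pos (by positivity)
  rw [aux_closedBall_vol, ENNReal.toReal_ofReal (by positivity)]

lemma vrad_pos (n : ℕ) : 0 < vrad n := by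
  have hG : 0 < Real.Gamma ((n:ℝ) / 2 + 1) := Real.Gamma_pos_of_pos (by positivity)
  rw [vrad, aux_vball]
  have := Real.pi_pos
  positivity

lemma vrad_sq {n : ℕ} (hn : 1 ≤ n) :
    vrad n ^ 2 = Real.pi / Real.Gamma (n / 2 + 1) ^ (1 / ((n:ℝ) / 2)) := by
  have hG : 0 < Real.Gamma ((n:ℝ) / 2 + 1) := Real.Gamma_pos_of_pos (by positivity)
  have hn' : (1:ℝ) ≤ n := by exact_mod_cast hn
  have hpi := Real.pi_pos
  rw [vrad, aux_vball, ← Real.rpow_natCast, ← Real.rpow_mul (by positivity),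
    Real.div_rpow (by positivity) hG.le]
  congr 1
  · rw [← Real.rpow_natCast (√Real.pi) n, ← Real.rpow_mul (by positivity), Real.sqrt_eq_rpow, ← Real.rpow_mul hpi.le]
    have : (1:ℝ) / 2 * ((n:ℝ) * (1 / n * ((2:ℕ):ℝ))) = 1 := by push_cast; field_simp
    rw [this, Real.rpow_one]
  · congr 1; push_cast; field_simp

lemma vrad_upper {n : ℕ} (hn : 1 ≤ n) : vrad n ^ 2 ≤ 2 * Real.pi * Real.exp 1 / n := by
  have hn' : (1:ℝ) ≤ n := by exact_mod_cast hn
  have hpi := Real.pi_pos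
  rw [vrad_sq hn]
  have hx : 0 < (n:ℝ) / 2 := by positivity
  have h := aux_gamma_lower hx
  have h2 : (n:ℝ) / 2 / Real.exp 1 ≤ Real.Gamma (n / 2 + 1) ^ (1 / ((n:ℝ) / 2)) := by
    calc (n:ℝ) / 2 / Real.exp 1 = (((n:ℝ) / 2 / Real.exp 1) ^ ((n:ℝ) / 2)) ^ (1 / ((n:ℝ) / 2)) := by
          rw [← Real.rpow_mul (by positivity), mul_one_div_cancel hx.ne', Real.rpow_one]
      _ ≤ _ := by gcongr
  calc _ ≤ Real.pi / ((n:ℝ) / 2 / Real.exp 1) := by gcongr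
    _ = _ := by field_simp

lemma vrad_lower {η : ℝ} (h1 : η < 1) :
    ∀ᶠ n : ℕ in atTop, η * (2 * Real.pi * Real.exp 1 / n) ≤ vrad n ^ 2 := by
  have hpi := Real.pi_pos
  obtain ⟨l, hl, hl1⟩ := exists_between (max_lt h1 one_pos)
  have hl0 : 0 < l := (le_max_right _ _).trans_lt hl
  have hηl : η < l := (le_max_left _ _).trans_lt hl
  have ht : Tendsto (fun n : ℕ => l * (1 - l) ^ (2 / (n:ℝ))) atTop (nhds (l * (1 - l) ^ (0:ℝ))) := by
    apply Tendsto.const_mul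
    exact (Real.continuousAt_const_rpow (a := 1 - l) (b := 0) (by linarith)).tendsto.comp
      (tendsto_const_div_atTop_nhds_zero_nat 2)
  rw [Real.rpow_zero, mul_one] at ht
  filter_upwards [ht.eventually (lt_mem_nhds hηl), eventually_ge_atTop 1] with n hn1 hn
  have hn' : (1:ℝ) ≤ n := by exact_mod_cast hn
  have hx : 0 < (n:ℝ) / 2 := by positivity
  have h1l : 0 < 1 - l := by linarith
  have hG : 0 < Real.Gamma ((n:ℝ) / 2 + 1) := Real.Gamma_pos_of_pos (by positivity)
  rw [vrad_sq hn]
  have h2 : Real.Gamma (n / 2 + 1) ^ (1 / ((n:ℝ) / 2)) ≤ (n:ℝ) / 2 / (l * Real.exp 1) / (1 - l) ^ (2 / (n:ℝ)) := by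
    calc _ ≤ (((n:ℝ) / 2 / (l * Real.exp 1)) ^ ((n:ℝ) / 2) / (1 - l)) ^ (1 / ((n:ℝ) / 2)) := by
          gcongr; exact aux_gamma_upper hx hl0 hl1
      _ = _ := by
          rw [Real.div_rpow (by positivity) h1l.le, ← Real.rpow_mul (by positivity),
            mul_one_div_cancel hx.ne', Real.rpow_one]
          congr 2; field_simp
  calc η * (2 * Real.pi * Real.exp 1 / n) ≤ (l * (1 - l) ^ (2 / (n:ℝ))) * (2 * Real.pi * Real.exp 1 / n) := by
        gcongr
    _ = Real.pi / ((n:ℝ) / 2 / (l * Real.exp 1) / (1 - l) ^ (2 / (n:ℝ))) := by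
        field_simp
    _ ≤ _ := by gcongr

lemma aux_polar_hull {n : ℕ} (M : Set (EuclideanSpace ℝ (Fin n) × ℝ)) :
    polarProd (convexHull ℝ M) = polarProd M := by
  ext y
  constructor
  · intro h z hz
    exact h z (subset_convexHull ℝ M hz)
  · intro h z hz
    have hc : Convex ℝ {z : EuclideanSpace ℝ (Fin n) × ℝ | ⟪y.1, z.1⟫ + y.2 * z.2 ≤ 1} := by
      intro z hz w hw a b ha hb hab
      simp only [Set.mem_ofPred_eq, Prod.fst_add, Prod.snd_add, Prod.smul_fst, Prod.smul_snd,
        inner_add_right, inner_smul_right, smul_eq_mul] at *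
      calc _ = a * (⟪y.1, z.1⟫ + y.2 * z.2) + b * (⟪y.1, w.1⟫ + y.2 * w.2) := by ring
        _ ≤ a * 1 + b * 1 := by gcongr
        _ = 1 := by linarith
    exact convexHull_min (fun z hz => h z hz) hc hz

/-- explicit description of the polar -/
def Pset (b : ℝ) (n : ℕ) : Set (EuclideanSpace ℝ (Fin n) × ℝ) :=
  {z | ‖z.1‖ ≤ (1 + z.2) * vrad n ∧ ∑ i, |z.1 i| ≤ 2 * (1 - b * z.2)}

lemma aux_polar_eq (b : ℝ) (n : ℕ) : polarProd (Mbody 1 b n) = Pset b n := by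
  rw [Mbody, aux_polar_hull]
  have hv := vrad_pos n
  ext ⟨y, s⟩
  simp only [Pset, Set.mem_ofPred_eq, polarProd]
  constructor
  · intro h
    constructor
    · have hz : ((vrad n)⁻¹ • (‖y‖⁻¹ • y), (-1:ℝ)) ∈
          (normBall n ×ˢ ({-1} : Set ℝ)) ∪ (normCube n ×ˢ ({b} : Set ℝ)) := by
        left
        refine ⟨Set.smul_mem_smul_set ?_, rfl⟩
        rw [mem_closedBall_zero_iff, norm_smul, norm_inv, norm_norm]
        exact inv_mul_le_one
      have := h _ hz
      simp only [inner_smul_right, real_inner_self_eq_norm_sq] at this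
      have e : ‖y‖⁻¹ * ‖y‖ ^ 2 = ‖y‖ := by
        by_cases hy : ‖y‖ = 0
        · rw [hy]; simp
        · field_simp
      rw [e] at this
      have h2 : (vrad n)⁻¹ * ‖y‖ ≤ 1 + s := by linarith
      rwa [inv_mul_le_iff₀ hv, mul_comm] at h2
    · have hz : ((1 / 2 : ℝ) • (WithLp.toLp 2 (fun i => (SignType.sign (y i) : ℝ)) :
            EuclideanSpace ℝ (Fin n)), b) ∈
          (normBall n ×ˢ ({-1} : Set ℝ)) ∪ (normCube n ×ˢ ({b} : Set ℝ)) := by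
        right
        refine ⟨Set.smul_mem_smul_set ?_, rfl⟩
        intro i
        rcases lt_trichotomy (y i) 0 with h | h | h <;> simp [h]
      have := h _ hz
      simp only [inner_smul_right] at this
      have e : ⟪y, (WithLp.toLp 2 (fun i => (SignType.sign (y i) : ℝ)) :
            EuclideanSpace ℝ (Fin n))⟫ = ∑ i, |y i| := by
        rw [PiLp.inner_apply]
        refine Finset.sum_congr rfl fun i _ => ?_
        simp
      rw [e] at this
      linarith
  · rintro ⟨h1, h2⟩ ⟨z, t⟩ hz
    rcases hz with ⟨hz, ht⟩ | ⟨hz, ht⟩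
    · obtain ⟨w, hw, rfl⟩ := hz
      simp only [Set.mem_singleton_iff] at ht
      subst ht
      rw [mem_closedBall_zero_iff] at hw
      simp only [inner_smul_right]
      have h3 : ⟪y, w⟫ ≤ ‖y‖ := by
        calc ⟪y, w⟫ ≤ ‖y‖ * ‖w‖ := real_inner_le_norm _ _
          _ ≤ ‖y‖ * 1 := by gcongr
          _ = _ := mul_one _
      have h4 : (vrad n)⁻¹ * ⟪y, w⟫ ≤ 1 + s := by
        rw [inv_mul_le_iff₀ hv]; linarith
      have h5 : ((volume (Metric.closedBall (0 : EuclideanSpace ℝ (Fin n)) 1)).toReal ^ (1 / (n : ℝ)))⁻¹ = (vrad n)⁻¹ := rfl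
      rw [h5]; linarith
    · obtain ⟨w, hw, rfl⟩ := hz
      simp only [Set.mem_singleton_iff] at ht
      subst ht
      simp only [inner_smul_right]
      have h3 : ⟪y, w⟫ ≤ ∑ i, |y i| := by
        rw [PiLp.inner_apply]
        refine Finset.sum_le_sum fun i _ => ?_
        have : |w i| ≤ 1 := hw i
        calc ⟪y i, w i⟫ ≤ |⟪y i, w i⟫| := le_abs_self _
          _ = |w i| * |y i| := by simp [abs_mul, mul_comm]
          _ ≤ 1 * |y i| := by gcongr
          _ = _ := one_mul _
      linarith

lemma Pset_closed (b : ℝ) (n : ℕ) : IsClosed (Pset b n) := by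
  have h1 : IsClosed {z : EuclideanSpace ℝ (Fin n) × ℝ | ‖z.1‖ ≤ (1 + z.2) * vrad n} :=
    isClosed_le (by fun_prop) (by fun_prop)
  have h2 : IsClosed {z : EuclideanSpace ℝ (Fin n) × ℝ | ∑ i, |z.1 i| ≤ 2 * (1 - b * z.2)} :=
    isClosed_le (by fun_prop) (by fun_prop)
  exact h1.inter h2

lemma Pset_range {b : ℝ} (hb : 0 < b) {n : ℕ} {z : EuclideanSpace ℝ (Fin n) × ℝ}
    (hz : z ∈ Pset b n) : -1 ≤ z.2 ∧ z.2 ≤ 1 / b := by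
  obtain ⟨h1, h2⟩ := hz
  have hv := vrad_pos n
  constructor
  · have := (norm_nonneg _).trans h1
    have := nonneg_of_mul_nonneg_left this hv
    linarith
  · have : 0 ≤ 2 * (1 - b * z.2) := (Finset.sum_nonneg fun i _ => abs_nonneg _).trans h2
    rw [le_div_iff₀ hb]; linarith

lemma Pset_compact {b : ℝ} (hb : 0 < b) (n : ℕ) : IsCompact (Pset b n) := by
  refine Metric.isCompact_of_isClosed_isBounded (Pset_closed b n) ?_
  refine (Bornology.IsBounded.prod (Metric.isBounded_closedBall (x := (0 : EuclideanSpace ℝ (Fin n)))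
    (r := (1 + 1 / b) * vrad n)) (Metric.isBounded_Icc (-1:ℝ) (1 / b))).subset ?_
  intro z hz
  have h := Pset_range hb hz
  refine ⟨?_, h⟩
  rw [mem_closedBall_zero_iff]
  refine hz.1.trans ?_
  have hv := vrad_pos n
  gcongr
  exact h.2

lemma centroid_snd {n : ℕ} {P : Set (EuclideanSpace ℝ (Fin n) × ℝ)} (hP : IsCompact P) :
    (centroid P).2 = ((volume P).toReal)⁻¹ * ∫ z in P, z.2 := by
  have hi : IntegrableOn (fun z : EuclideanSpace ℝ (Fin n) × ℝ => z) P :=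
    continuous_id.continuousOn.integrableOn_compact hP
  have := (ContinuousLinearMap.snd ℝ (EuclideanSpace ℝ (Fin n)) ℝ).integral_comp_comm hi
  rw [centroid, Prod.smul_snd, smul_eq_mul]
  congr 1
  exact this.symm

lemma centroid_lower {n : ℕ} {P : Set (EuclideanSpace ℝ (Fin n) × ℝ)} (hP : IsCompact P)
    (h0 : volume P ≠ 0) {τ C δ : ℝ} (hC : 0 ≤ C) (hδ : 0 ≤ δ) (hl : ∀ z ∈ P, -C ≤ z.2 - τ)
    (hA : volume (P ∩ {z | z.2 < τ}) ≤ ENNReal.ofReal δ * volume P) :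
    τ - C * δ ≤ (centroid P).2 := by
  have hfin : volume P ≠ ⊤ := hP.measure_lt_top.ne
  have hpos : 0 < (volume P).toReal := ENNReal.toReal_pos h0 hfin
  rw [centroid_snd hP]
  have hi : IntegrableOn (fun z : EuclideanSpace ℝ (Fin n) × ℝ => z.2) P :=
    continuous_snd.continuousOn.integrableOn_compact hP
  have hms : MeasurableSet {z : EuclideanSpace ℝ (Fin n) × ℝ | z.2 < τ} :=
    measurableSet_lt measurable_snd measurable_const
  have hA' : (volume (P ∩ {z | z.2 < τ})).toReal ≤ δ * (volume P).toReal := by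
    have := ENNReal.toReal_mono (ENNReal.mul_ne_top ENNReal.ofReal_ne_top hfin) hA
    rwa [ENNReal.toReal_mul, ENNReal.toReal_ofReal hδ] at this
  have hi2 : IntegrableOn (fun z : EuclideanSpace ℝ (Fin n) × ℝ => ({z | z.2 < τ} : Set (EuclideanSpace ℝ (Fin n) × ℝ)).indicator (fun _ => -C) z) P := by
    exact (integrableOn_const hfin).indicator hms
  have hconst : IntegrableOn (fun _ : EuclideanSpace ℝ (Fin n) × ℝ => τ) P := integrableOn_const hfin
  have h1 : ∫ z in P, (τ + ({z | z.2 < τ} : Set (EuclideanSpace ℝ (Fin n) × ℝ)).indicator (fun _ => -C) z) ≤ ∫ z in P, z.2 := by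
    refine setIntegral_mono_on (hconst.add hi2) hi hP.measurableSet ?_
    intro z hz
    by_cases hzt : z.2 < τ
    · rw [Set.indicator_of_mem (by exact hzt)]
      linarith [hl z hz]
    · rw [Set.indicator_of_notMem (by exact hzt)]
      linarith
  rw [integral_add hconst hi2, setIntegral_const, integral_indicator hms, Measure.restrict_restrict hms,
    setIntegral_const, Set.inter_comm] at h1
  simp only [smul_eq_mul, Measure.real] at h1
  rw [inv_mul_eq_div, le_div_iff₀ hpos]
  nlinarith [mul_le_mul_of_nonneg_left hA' hC]

lemma centroid_upper {n : ℕ} {P : Set (EuclideanSpace ℝ (Fin n) × ℝ)} (hP : IsCompact P)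
    (h0 : volume P ≠ 0) {τ C δ : ℝ} (hC : 0 ≤ C) (hδ : 0 ≤ δ) (hl : ∀ z ∈ P, z.2 - τ ≤ C)
    (hA : volume (P ∩ {z | τ < z.2}) ≤ ENNReal.ofReal δ * volume P) :
    (centroid P).2 ≤ τ + C * δ := by
  have hfin : volume P ≠ ⊤ := hP.measure_lt_top.ne
  have hpos : 0 < (volume P).toReal := ENNReal.toReal_pos h0 hfin
  rw [centroid_snd hP]
  have hi : IntegrableOn (fun z : EuclideanSpace ℝ (Fin n) × ℝ => z.2) P :=
    continuous_snd.continuousOn.integrableOn_compact hP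
  have hms : MeasurableSet {z : EuclideanSpace ℝ (Fin n) × ℝ | τ < z.2} :=
    measurableSet_lt measurable_const measurable_snd
  have hA' : (volume (P ∩ {z | τ < z.2})).toReal ≤ δ * (volume P).toReal := by
    have := ENNReal.toReal_mono (ENNReal.mul_ne_top ENNReal.ofReal_ne_top hfin) hA
    rwa [ENNReal.toReal_mul, ENNReal.toReal_ofReal hδ] at this
  have hi2 : IntegrableOn (fun z : EuclideanSpace ℝ (Fin n) × ℝ => ({z | τ < z.2} : Set (EuclideanSpace ℝ (Fin n) × ℝ)).indicator (fun _ => C) z) P := by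
    exact (integrableOn_const hfin).indicator hms
  have hconst : IntegrableOn (fun _ : EuclideanSpace ℝ (Fin n) × ℝ => τ) P := integrableOn_const hfin
  have h1 : ∫ z in P, z.2 ≤ ∫ z in P, (τ + ({z | τ < z.2} : Set (EuclideanSpace ℝ (Fin n) × ℝ)).indicator (fun _ => C) z) := by
    refine setIntegral_mono_on hi (hconst.add hi2) hP.measurableSet ?_
    intro z hz
    by_cases hzt : τ < z.2
    · rw [Set.indicator_of_mem (by exact hzt)]
      linarith [hl z hz]
    · rw [Set.indicator_of_notMem (by exact hzt)]
      linarith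
  rw [integral_add hconst hi2, setIntegral_const, integral_indicator hms, Measure.restrict_restrict hms,
    setIntegral_const, Set.inter_comm] at h1
  simp only [smul_eq_mul, Measure.real] at h1
  rw [inv_mul_eq_div, div_le_iff₀ hpos]
  nlinarith [mul_le_mul_of_nonneg_left hA' hC]

lemma aux_ratio {a₁ a₂ l₁ l₂ κ δ : ℝ} (h0 : 0 ≤ a₁) (h12 : a₁ < a₂) (hl₂ : 0 < l₂)
    (hκ : 0 < κ) (hδ : 0 < δ) :
    ∀ᶠ n : ℕ in atTop, a₁ ^ n * l₁ ≤ δ * (κ * a₂ ^ n * l₂) := by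
  have ha₂ : 0 < a₂ := h0.trans_lt h12
  have ht : Tendsto (fun n : ℕ => (a₁ / a₂) ^ n * l₁) atTop (nhds (0 * l₁)) :=
    (tendsto_pow_atTop_nhds_zero_of_lt_one (by positivity) ((div_lt_one ha₂).2 h12)).mul_const _
  rw [zero_mul] at ht
  have hp : 0 < δ * (κ * l₂) := by positivity
  filter_upwards [ht.eventually (gt_mem_nhds hp)] with n hn
  rw [div_pow, div_mul_eq_mul_div, div_lt_iff₀ (by positivity)] at hn
  nlinarith

lemma aux_transfer {n : ℕ} {R T : ℝ} (hR : 0 ≤ R) :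
    volume {y : EuclideanSpace ℝ (Fin n) | ‖y‖ ≤ R ∧ ∑ i, |y i| ≤ T} =
    volume {x : Fin n → ℝ | ∑ i, |x i| ^ (2:ℝ) ≤ R ^ 2 ∧ ∑ i, |x i| ^ (1:ℝ) ≤ T} := by
  have hm : MeasurableSet {x : Fin n → ℝ | ∑ i, |x i| ^ (2:ℝ) ≤ R ^ 2 ∧ ∑ i, |x i| ^ (1:ℝ) ≤ T} :=
    (measurableSet_le (aux_meas 2) measurable_const).inter
      (measurableSet_le (aux_meas 1) measurable_const)
  rw [← (PiLp.volume_preserving_ofLp (Fin n)).measure_preimage hm.nullMeasurableSet]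
  congr 1
  ext y
  simp only [Set.mem_ofPred_eq, Set.mem_preimage, aux_ball_iff y hR, Real.rpow_one]

lemma aux_transfer_ball {n : ℕ} {R : ℝ} (hR : 0 ≤ R) :
    volume (Metric.closedBall (0 : EuclideanSpace ℝ (Fin n)) R) =
    volume {x : Fin n → ℝ | ∑ i, |x i| ^ (2:ℝ) ≤ R ^ 2} := by
  have hm : MeasurableSet {x : Fin n → ℝ | ∑ i, |x i| ^ (2:ℝ) ≤ R ^ 2} :=
    (measurableSet_le (aux_meas 2) measurable_const)
  rw [← (PiLp.volume_preserving_ofLp (Fin n)).measure_preimage hm.nullMeasurableSet]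
  congr 1
  ext y
  simp only [Set.mem_ofPred_eq, Set.mem_preimage, mem_closedBall_zero_iff, aux_ball_iff y hR]

lemma aux_transfer_cross {n : ℕ} {T : ℝ} :
    volume {y : EuclideanSpace ℝ (Fin n) | ∑ i, |y i| ≤ T} =
    volume {x : Fin n → ℝ | ∑ i, |x i| ^ (1:ℝ) ≤ T} := by
  have hm : MeasurableSet {x : Fin n → ℝ | ∑ i, |x i| ^ (1:ℝ) ≤ T} :=
    (measurableSet_le (aux_meas 1) measurable_const)
  rw [← (PiLp.volume_preserving_ofLp (Fin n)).measure_preimage hm.nullMeasurableSet]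
  congr 1
  ext y
  simp only [Set.mem_ofPred_eq, Set.mem_preimage, Real.rpow_one]

lemma aux_P_lower {b s t : ℝ} (hb : 0 < b) (n : ℕ) :
    volume {y : EuclideanSpace ℝ (Fin n) | ‖y‖ ≤ (1 + s) * vrad n ∧ ∑ i, |y i| ≤ 2 * (1 - b * t)} *
      ENNReal.ofReal (t - s) ≤ volume (Pset b n) := by
  rw [← Real.volume_Icc, ← Measure.prod_prod, ← Measure.volume_eq_prod]
  apply measure_mono
  rintro ⟨y, r⟩ ⟨⟨h1, h2⟩, h3, h4⟩
  have hv := vrad_pos n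
  dsimp only at *
  refine ⟨h1.trans ?_, h2.trans ?_⟩
  · dsimp only; gcongr
  · dsimp only; gcongr

/-- conclusion of the mass comparison -/
lemma aux_compare {X Y W : ENNReal} {a₁ a₂ l₁ l₂ κ δ : ℝ} {n : ℕ} (hδ : 0 < δ)
    (hX : X ≤ ENNReal.ofReal (a₁ ^ n * l₁) * W) (hY : ENNReal.ofReal (κ * a₂ ^ n * l₂) * W ≤ Y)
    (h : a₁ ^ n * l₁ ≤ δ * (κ * a₂ ^ n * l₂)) : X ≤ ENNReal.ofReal δ * Y := by
  calc X ≤ ENNReal.ofReal (δ * (κ * a₂ ^ n * l₂)) * W := hX.trans (by gcongr)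
    _ = ENNReal.ofReal δ * (ENNReal.ofReal (κ * a₂ ^ n * l₂) * W) := by
      rw [ENNReal.ofReal_mul hδ.le, mul_assoc]
    _ ≤ _ := by gcongr

lemma aux_lower_mass {b τ s t δ : ℝ} (hb : 0 < b) (hτ : -1 ≤ τ) (hτs : τ < s) (hst : s < t)
    (hkey : (1 + s) * √(Real.exp 1) < 1 - b * t) (hδ : 0 < δ) :
    ∀ᶠ n : ℕ in atTop, volume (Pset b n) ≠ 0 ∧
      volume (Pset b n ∩ {z | z.2 < τ}) ≤ ENNReal.ofReal δ * volume (Pset b n) := by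
  have hpi := Real.pi_pos
  have hs1 : 0 < 1 + s := by linarith
  have hT : 0 < 1 - b * t := lt_trans (by positivity) hkey
  set κ : ℝ := 1 - (1 + s) * √(Real.exp 1) / (1 - b * t) with hκ
  have hκ0 : 0 < κ := by
    rw [hκ, sub_pos, div_lt_one hT]; exact hkey
  have hκ1 : κ ≤ 1 := by
    rw [hκ]; linarith [show 0 ≤ (1 + s) * √(Real.exp 1) / (1 - b * t) by positivity]
  filter_upwards [eventually_ge_atTop 1, aux_ratio (a₁ := 1 + τ) (a₂ := 1 + s) (l₁ := τ - (-1)) (l₂ := t - s)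
    (by linarith) (by linarith) (by linarith) hκ0 hδ] with n hn hrat
  have hn' : (1:ℝ) ≤ n := by exact_mod_cast hn
  have hv := vrad_pos n
  set W := volume (Metric.closedBall (0 : EuclideanSpace ℝ (Fin n)) (vrad n)) with hW
  have hW0 : W ≠ 0 := (Metric.measure_closedBall_pos volume _ hv).ne'
  have hsc : ∀ a : ℝ, 0 ≤ a → volume (Metric.closedBall (0 : EuclideanSpace ℝ (Fin n)) (a * vrad n)) = ENNReal.ofReal (a ^ n) * W := by
    intro a ha
    rw [hW, Measure.addHaar_closedBall_mul _ _ ha hv.le]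
    simp
  have hR : 0 < (1 + s) * vrad n := by positivity
  have hm := aux_markov_ball hn (R := (1 + s) * vrad n) (T := 2 * (1 - b * t)) (κ := κ) hR
    (by linarith) hκ0.le hκ1 (by
      have h1 : √(2 * n / Real.pi) * vrad n ≤ 2 * √(Real.exp 1) := by
        have h2 : vrad n ≤ √(2 * Real.pi * Real.exp 1 / n) := Real.le_sqrt_of_sq_le (vrad_upper hn)
        calc _ ≤ √(2 * n / Real.pi) * √(2 * Real.pi * Real.exp 1 / n) := by gcongr
          _ = √(2 ^ 2 * Real.exp 1) := by
            rw [← Real.sqrt_mul (by positivity)]; congr 1; field_simp; try norm_num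
          _ = _ := by rw [Real.sqrt_mul (by positivity), Real.sqrt_sq (by norm_num)]
      have h3 : (1 - κ) * (2 * (1 - b * t)) = (1 + s) * (2 * √(Real.exp 1)) := by
        rw [hκ]; field_simp; ring
      rw [h3]
      calc _ = (1 + s) * (√(2 * n / Real.pi) * vrad n) := by ring
        _ ≤ _ := by gcongr)
  rw [← aux_transfer_ball hR.le, ← aux_transfer hR.le, hsc _ hs1.le] at hm
  have hY : ENNReal.ofReal (κ * (1 + s) ^ n * (t - s)) * W ≤ volume (Pset b n) := by
    refine le_trans ?_ (aux_P_lower hb n (s := s) (t := t))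
    calc _ = ENNReal.ofReal κ * (ENNReal.ofReal ((1 + s) ^ n) * W) * ENNReal.ofReal (t - s) := by
          rw [ENNReal.ofReal_mul (by positivity), ENNReal.ofReal_mul hκ0.le]; ring
      _ ≤ _ := by gcongr
  have hX : volume (Pset b n ∩ {z | z.2 < τ}) ≤ ENNReal.ofReal ((1 + τ) ^ n * (τ - (-1))) * W := by
    calc _ ≤ volume (Metric.closedBall (0 : EuclideanSpace ℝ (Fin n)) ((1 + τ) * vrad n) ×ˢ Set.Icc (-1) τ) := by
          apply measure_mono
          rintro z ⟨hz, hzt⟩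
          have hzt' : z.2 < τ := hzt
          refine ⟨?_, (Pset_range hb hz).1, hzt'.le⟩
          rw [mem_closedBall_zero_iff]
          refine hz.1.trans ?_
          gcongr
      _ = _ := by
          rw [Measure.volume_eq_prod, Measure.prod_prod, Real.volume_Icc, hsc _ (by linarith),
            ENNReal.ofReal_mul (pow_nonneg (by linarith) n)]
          ring
  refine ⟨?_, aux_compare hδ hX hY hrat⟩
  refine (lt_of_lt_of_le ?_ hY).ne'
  refine ENNReal.mul_pos ?_ hW0
  have : 0 < t - s := by linarith
  simp only [ne_eq, ENNReal.ofReal_eq_zero, not_le]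
  positivity

lemma aux_upper_mass {b τ s t δ : ℝ} (hb : 0 < b) (hτ : τ < 1 / b) (hst : s < t) (htτ : t < τ)
    (hs1 : 0 < 1 + s)
    (hkey : 2 * (1 - b * t) < (1 + s) * √(Real.exp 1 * Real.pi)) (hδ : 0 < δ) :
    ∀ᶠ n : ℕ in atTop, volume (Pset b n) ≠ 0 ∧
      volume (Pset b n ∩ {z | τ < z.2}) ≤ ENNReal.ofReal δ * volume (Pset b n) := by
  have hpi := Real.pi_pos
  have hbτ : 0 < 1 - b * τ := by
    rw [lt_div_iff₀ hb] at hτ; linarith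
  have hbt : 1 - b * τ < 1 - b * t := by nlinarith
  have hT : 0 < 1 - b * t := hbτ.trans hbt
  have hsq : 4 * (1 - b * t) ^ 2 < (1 + s) ^ 2 * (Real.exp 1 * Real.pi) := by
    have h1 : (2 * (1 - b * t)) ^ 2 < ((1 + s) * √(Real.exp 1 * Real.pi)) ^ 2 :=
      pow_lt_pow_left₀ hkey (by positivity) (by norm_num)
    rw [mul_pow, mul_pow, Real.sq_sqrt (by positivity)] at h1
    linarith
  set D := (1 + s) ^ 2 * (Real.exp 1 * Real.pi) with hD
  have hD0 : 0 < D := by positivity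
  obtain ⟨η, hη1, hη2⟩ := exists_between ((div_lt_one hD0).2 hsq)
  have hη0 : 0 < η := lt_trans (by positivity) hη1
  rw [div_lt_iff₀ hD0] at hη1
  set κ : ℝ := 1 - 4 * (1 - b * t) ^ 2 / (η * D) with hκ
  have hκ0 : 0 < κ := by
    rw [hκ, sub_pos, div_lt_one (by positivity)]; exact hη1
  have hκ1 : κ ≤ 1 := by
    rw [hκ]; linarith [show 0 ≤ 4 * (1 - b * t) ^ 2 / (η * D) by positivity]
  filter_upwards [eventually_ge_atTop 1, vrad_lower hη2, aux_ratio (a₁ := 1 - b * τ) (a₂ := 1 - b * t) (l₁ := 1 / b - τ) (l₂ := t - s)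
    hbτ.le hbt (by linarith) hκ0 hδ] with n hn hvl hrat
  have hn' : (1:ℝ) ≤ n := by exact_mod_cast hn
  have hv := vrad_pos n
  have h2pos : (0:ℝ) < 2 := by norm_num
  set W := volume {x : Fin n → ℝ | ∑ i, |x i| ^ (1:ℝ) ≤ 2} with hW
  have hsc : ∀ a : ℝ, 0 < a → volume {x : Fin n → ℝ | ∑ i, |x i| ^ (1:ℝ) ≤ 2 * a} = ENNReal.ofReal (a ^ n) * W := by
    intro a ha
    rw [hW, aux_vol_scale one_pos (2 * a) (by positivity), aux_vol_scale one_pos 2 h2pos, ← mul_assoc,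
      ← ENNReal.ofReal_mul (by positivity)]
    simp only [div_one, Real.rpow_natCast, mul_pow]
    rw [mul_comm (a ^ n)]
  have hW0 : W ≠ 0 := by
    have hG : 0 < Real.Gamma ((n:ℝ) / 1 + 1) := Real.Gamma_pos_of_pos (by positivity)
    have hC : 0 < 2 / 1 * Real.Gamma (1 / 1) := by simp
    rw [hW, aux_vol_scale one_pos 2 h2pos, aux_vol' one_pos, ← ENNReal.ofReal_mul (by positivity)]
    simp only [ne_eq, ENNReal.ofReal_eq_zero, not_le]
    positivity
  have hR : 0 < (1 + s) * vrad n := by positivity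
  have hm := aux_markov_cross hn (R := 2 * (1 - b * t)) (T := ((1 + s) * vrad n) ^ 2) (κ := κ)
    (by positivity) (by positivity) hκ0.le hκ1 (by
      have h3 : (1 - κ) * (η * D) = 4 * (1 - b * t) ^ 2 := by
        rw [hκ]; field_simp; try ring
      calc 2 / n * (2 * (1 - b * t)) ^ 2 = 2 / n * ((1 - κ) * (η * D)) := by rw [h3]; ring
        _ = (1 - κ) * ((1 + s) ^ 2 * (η * (2 * Real.pi * Real.exp 1 / n))) := by rw [hD]; ring
        _ ≤ (1 - κ) * ((1 + s) ^ 2 * vrad n ^ 2) := by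
          have : 0 ≤ 1 - κ := by linarith
          gcongr
        _ = _ := by ring)
  have hswap : {x : Fin n → ℝ | ∑ i, |x i| ^ (1:ℝ) ≤ 2 * (1 - b * t) ∧ ∑ i, |x i| ^ (2:ℝ) ≤ ((1 + s) * vrad n) ^ 2}
      = {x : Fin n → ℝ | ∑ i, |x i| ^ (2:ℝ) ≤ ((1 + s) * vrad n) ^ 2 ∧ ∑ i, |x i| ^ (1:ℝ) ≤ 2 * (1 - b * t)} := by
    ext x; exact and_comm
  rw [hswap, ← aux_transfer hR.le, hsc _ hT] at hm
  have hY : ENNReal.ofReal (κ * (1 - b * t) ^ n * (t - s)) * W ≤ volume (Pset b n) := by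
    refine le_trans ?_ (aux_P_lower hb n (s := s) (t := t))
    calc _ = ENNReal.ofReal κ * (ENNReal.ofReal ((1 - b * t) ^ n) * W) * ENNReal.ofReal (t - s) := by
          rw [ENNReal.ofReal_mul (by positivity), ENNReal.ofReal_mul hκ0.le]; ring
      _ ≤ _ := by gcongr
  have hX : volume (Pset b n ∩ {z | τ < z.2}) ≤ ENNReal.ofReal ((1 - b * τ) ^ n * (1 / b - τ)) * W := by
    calc _ ≤ volume ({y : EuclideanSpace ℝ (Fin n) | ∑ i, |y i| ≤ 2 * (1 - b * τ)} ×ˢ Set.Icc τ (1 / b)) := by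
          apply measure_mono
          rintro z ⟨hz, hzt⟩
          have hzt' : τ < z.2 := hzt
          refine ⟨hz.2.trans ?_, hzt'.le, (Pset_range hb hz).2⟩
          gcongr
      _ = _ := by
          rw [Measure.volume_eq_prod, Measure.prod_prod, Real.volume_Icc, aux_transfer_cross, hsc _ hbτ,
            ENNReal.ofReal_mul (pow_nonneg hbτ.le n)]
          ring
  refine ⟨?_, aux_compare hδ hX hY hrat⟩
  refine (lt_of_lt_of_le ?_ hY).ne'
  refine ENNReal.mul_pos ?_ hW0
  have : 0 < t - s := by linarith
  simp only [ne_eq, ENNReal.ofReal_eq_zero, not_le]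
  positivity

theorem aux_main {b s₀ s₁ : ℝ} (hb : 0 < b) (h0 : -1 < s₀) (h0' : s₀ ≤ 0) (h1 : s₁ < 1 / b) (h1' : -1 < s₁)
    (e0 : (1 + s₀) * √(Real.exp 1) = 1 - b * s₀)
    (e1 : 2 * (1 - b * s₁) = (1 + s₁) * √(Real.exp 1 * Real.pi)) :
    ∀ ε > (0 : ℝ), ∃ n₀ : ℕ, ∀ n ≥ n₀,
      s₀ - ε ≤ (centroid (polarProd (Mbody 1 b n))).2 ∧
        (centroid (polarProd (Mbody 1 b n))).2 ≤ s₁ + ε := by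
  intro ε hε
  have hpi := Real.pi_pos
  have hse : 0 < √(Real.exp 1) := by positivity
  have hsp : 0 < √(Real.exp 1 * Real.pi) := by positivity
  set C : ℝ := 1 / b + 1 with hC
  have hC0 : 0 < C := by positivity
  -- lower
  obtain ⟨d, hd0, hd⟩ := exists_between (show (0:ℝ) < min (ε / 2) (min (1 + s₀) (1 / b - s₁)) from
    lt_min (by linarith) (lt_min (by linarith) (by linarith)))
  have hdε := hd.trans_le (min_le_left _ _)
  have hd1 := hd.trans_le ((min_le_right _ _).trans (min_le_left _ _))
  have hd2 := hd.trans_le ((min_le_right _ _).trans (min_le_right _ _))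
  set δ : ℝ := ε / 2 / C with hδ
  have hδ0 : 0 < δ := by positivity
  have hCδ : C * δ = ε / 2 := by rw [hδ]; field_simp
  have hlow := aux_lower_mass (b := b) (τ := s₀ - d) (s := s₀ - d / 2) (t := s₀ - d / 4) (δ := δ) hb
    (by linarith) (by linarith) (by linarith) (by nlinarith [mul_pos hb hd0, mul_pos hse hd0]) hδ0
  have hupp := aux_upper_mass (b := b) (τ := s₁ + d) (s := s₁ + d / 4) (t := s₁ + d / 2) (δ := δ) hb
    (by linarith) (by linarith) (by linarith) (by linarith)
    (by nlinarith [mul_pos hb hd0, mul_pos hsp hd0]) hδ0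
  obtain ⟨n₀, hn₀⟩ := eventually_atTop.1 (hlow.and hupp)
  refine ⟨n₀, fun n hn => ?_⟩
  obtain ⟨⟨hv, hl⟩, _, hu⟩ := hn₀ n hn
  have hb' : 0 < 1 / b := by positivity
  rw [aux_polar_eq]
  constructor
  · have := centroid_lower (Pset_compact hb n) hv (τ := s₀ - d) (C := C) (δ := δ) hC0.le hδ0.le
      (fun z hz => by have := (Pset_range hb hz).1; linarith) hl
    linarith
  · have := centroid_upper (Pset_compact hb n) hv (τ := s₁ + d) (C := C) (δ := δ) hC0.le hδ0.le
      (fun z hz => by have := (Pset_range hb hz).2; linarith) hu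
    linarith

/-- With `a = 1`, `b = 1/(e-1)`, `s₀ = -(√e-1)/(√e+1/(e-1))` and
`s₁ = (2-√(eπ))/(√(eπ)+2/(e-1))`: for every `ε > 0` there is `n₀` such that for all
`n ≥ n₀` the last coordinate of the centroid of `M_n^∘` lies in `[s₀ - ε, s₁ + ε]`. -/
theorem centroid_of_polar_Mbody_bounds :
    ∀ ε > (0 : ℝ), ∃ n₀ : ℕ, ∀ n ≥ n₀,
      -(Real.sqrt (Real.exp 1) - 1) / (Real.sqrt (Real.exp 1) + 1 / (Real.exp 1 - 1)) - ε ≤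
          (centroid (polarProd (Mbody 1 (1 / (Real.exp 1 - 1)) n))).2 ∧
        (centroid (polarProd (Mbody 1 (1 / (Real.exp 1 - 1)) n))).2 ≤
          (2 - Real.sqrt (Real.exp 1 * Real.pi)) /
              (Real.sqrt (Real.exp 1 * Real.pi) + 2 / (Real.exp 1 - 1)) + ε := by
  have he : (1:ℝ) < Real.exp 1 := by simp
  have hpi := Real.pi_gt_three
  have hE : 0 < Real.exp 1 - 1 := by linarith
  set b : ℝ := 1 / (Real.exp 1 - 1) with hb
  have hb0 : 0 < b := by positivity
  have hse : 1 < √(Real.exp 1) := by rw [Real.lt_sqrt (by norm_num)]; linarith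
  have hsp : 0 < √(Real.exp 1 * Real.pi) := by positivity
  have h2b : 2 / (Real.exp 1 - 1) = 2 * b := by rw [hb]; ring
  rw [h2b]
  set x := √(Real.exp 1) with hx
  set y := √(Real.exp 1 * Real.pi) with hy
  have hx0 : 0 < x + b := by linarith
  have hy0 : 0 < y + 2 * b := by linarith
  apply aux_main hb0
  · rw [lt_div_iff₀ hx0]; linarith
  · apply div_nonpos_of_nonpos_of_nonneg <;> linarith
  · rw [div_lt_div_iff₀ hy0 hb0]; nlinarith [mul_pos hb0 hb0]
  · rw [lt_div_iff₀ hy0]; linarith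
  · field_simp; ring
  · field_simp; ring
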